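/- arXiv:2601.04081 — 6 statements merged into one kernel-verified Lean document; each statement's English description precedes it below -/
import Mathlib

section
/- The logical consequence relation ⊢_CL of classical propositional logic, defined as the smallest structural and non-trivial logical consequence relation satisfying: (i) ⊥, Γ ⊢ Δ; (ii) Γ ⊢ Δ, ¬A₁ iff A₁, Γ ⊢ Δ; (iii) Γ ⊢ Δ, A₁ ∧ A₂ iff (Γ ⊢ Δ, A₁ and Γ ⊢ Δ, A₂); (iv) A₁ ∨ A₂, Γ ⊢ Δ iff (A₁, Γ ⊢ Δ and A₂, Γ ⊢ Δ); (v) Γ ⊢ Δ, A₁ → A₂ iff A₁, Γ ⊢ Δ, A₂, coincides with the smallest structural and non-trivial logical consequence relation satisfying, for all sets of formulas Γ, Δ and formulas A₁, A₂: ⊥, Γ ⊢ Δ; Γ ⊢ Δ, A₁ ∧ A₂ iff (Γ ⊢ Δ, A₁ and Γ ⊢ Δ, A₂); A₁ ∨ A₂, Γ ⊢ Δ iff (A₁, Γ ⊢ Δ and A₂, Γ ⊢ Δ); Γ ⊢ Δ, A₁ → A₂ iff A₁, Γ ⊢ Δ, A₂; ¬A₁, A₁ ⊢ ⊥; ¬⊥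 ⊢ A₁, ¬A₁; Γ ⊢ Δ, ¬⊥; ¬¬A₁, Γ ⊢ Δ iff A₁, Γ ⊢ Δ; ¬(A₁ ∧ A₂), Γ ⊢ Δ iff (¬A₁, Γ ⊢ Δ and ¬A₂, Γ ⊢ Δ); Γ ⊢ Δ, ¬(A₁ ∨ A₂) iff (Γ ⊢ Δ, ¬A₁ and Γ ⊢ Δ, ¬A₂); ¬(A₁ → A₂), Γ ⊢ Δ iff A₁, ¬A₂, Γ ⊢ Δ. -/
/-- Formulas over a countably infinite set of propositional variables,
with connectives ⊥ (falsity), ¬ (negation), and ∧, ∨, → (binary). -/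
inductive Form : Type
  | var : ℕ → Form
  | fls : Form
  | neg : Form → Form
  | conj : Form → Form → Form
  | disj : Form → Form → Form
  | impl : Form → Form → Form

/-- Substitution of formulas for propositional variables. -/
def Form.subst (σ : ℕ → Form) : Form → Form
  | .var p => σ p
  | .fls => .fls
  | .neg A => .neg (A.subst σ)
  | .conj A B => .conj (A.subst σ) (B.subst σ)
  | .disj A B => .disj (A.subst σ) (B.subst σ)
  | .impl A B => .impl (A.subst σ) (B.subst σ)

/-- A (Scott) logical consequence relation: reflexivity, monotonicity, cut. -/
def IsConsRel (C : Set Form → Set Form → Prop) : Prop :=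
  (∀ Γ Δ : Set Form, (Γ ∩ Δ).Nonempty → C Γ Δ) ∧
  (∀ Γ Δ Γ' Δ' : Set Form, C Γ Δ → Γ ⊆ Γ' → Δ ⊆ Δ' → C Γ' Δ') ∧
  (∀ (Γ Δ Γ' Δ' : Set Form) (A : Form),
    C Γ (insert A Δ) → C (insert A Γ') Δ' → C (Γ ∪ Γ') (Δ ∪ Δ'))

/-- Structurality: closure under substitutions. -/
def Structural (C : Set Form → Set Form → Prop) : Prop :=
  ∀ (Γ Δ : Set Form) (σ : ℕ → Form), C Γ Δ → C (Form.subst σ '' Γ) (Form.subst σ '' Δ)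

/-- Non-triviality: some non-empty Γ, Δ with ¬ C Γ Δ. -/
def NonTrivial (C : Set Form → Set Form → Prop) : Prop :=
  ∃ Γ Δ : Set Form, Γ.Nonempty ∧ Δ.Nonempty ∧ ¬ C Γ Δ

/-- Defining conditions of the classical consequence relation ⊢_CL. -/
def CLconds (C : Set Form → Set Form → Prop) : Prop :=
  (∀ Γ Δ : Set Form, C (insert Form.fls Γ) Δ) ∧
  (∀ (Γ Δ : Set Form) (A : Form), C Γ (insert (Form.neg A) Δ) ↔ C (insert A Γ) Δ) ∧
  (∀ (Γ Δ : Set Form) (A B : Form),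
    C Γ (insert (Form.conj A B) Δ) ↔ C Γ (insert A Δ) ∧ C Γ (insert B Δ)) ∧
  (∀ (Γ Δ : Set Form) (A B : Form),
    C (insert (Form.disj A B) Γ) Δ ↔ C (insert A Γ) Δ ∧ C (insert B Γ) Δ) ∧
  (∀ (Γ Δ : Set Form) (A B : Form),
    C Γ (insert (Form.impl A B) Δ) ↔ C (insert A Γ) (insert B Δ))

/-- Defining conditions of the consequence relation ⊢_BDL. -/
def BDLconds (C : Set Form → Set Form → Prop) : Prop :=
  (∀ Γ Δ : Set Form, C (insert Form.fls Γ) Δ) ∧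
  (∀ (Γ Δ : Set Form) (A B : Form),
    C Γ (insert (Form.conj A B) Δ) ↔ C Γ (insert A Δ) ∧ C Γ (insert B Δ)) ∧
  (∀ (Γ Δ : Set Form) (A B : Form),
    C (insert (Form.disj A B) Γ) Δ ↔ C (insert A Γ) Δ ∧ C (insert B Γ) Δ) ∧
  (∀ (Γ Δ : Set Form) (A B : Form),
    C Γ (insert (Form.impl A B) Δ) ↔ C (insert A Γ) (insert B Δ)) ∧
  (∀ Γ Δ : Set Form, C Γ (insert (Form.neg Form.fls) Δ)) ∧
  (∀ (Γ Δ : Set Form) (A : Form),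
    C (insert (Form.neg (Form.neg A)) Γ) Δ ↔ C (insert A Γ) Δ) ∧
  (∀ (Γ Δ : Set Form) (A B : Form),
    C (insert (Form.neg (Form.conj A B)) Γ) Δ ↔
      C (insert (Form.neg A) Γ) Δ ∧ C (insert (Form.neg B) Γ) Δ) ∧
  (∀ (Γ Δ : Set Form) (A B : Form),
    C Γ (insert (Form.neg (Form.disj A B)) Δ) ↔
      C Γ (insert (Form.neg A) Δ) ∧ C Γ (insert (Form.neg B) Δ)) ∧
  (∀ (Γ Δ : Set Form) (A B : Form),
    C (insert (Form.neg (Form.impl A B)) Γ) Δ ↔ C (insert A (insert (Form.neg B) Γ)) Δ)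

/-- The law of non-contradiction: ¬A, A ⊢ ⊥. -/
def LNC (C : Set Form → Set Form → Prop) : Prop :=
  ∀ A : Form, C {Form.neg A, A} {Form.fls}

/-- The law of excluded middle: ¬⊥ ⊢ A, ¬A. -/
def LEM (C : Set Form → Set Form → Prop) : Prop :=
  ∀ A : Form, C {Form.neg Form.fls} {A, Form.neg A}

/-- The alternative defining conditions of ⊢_CL (Theorem 1 of the paper):
the BDL conditions together with LNC and LEM. -/
def AltConds (C : Set Form → Set Form → Prop) : Prop :=
  BDLconds C ∧ LNC C ∧ LEM C

/-- `C` is the smallest structural and non-trivial logical consequence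
relation satisfying the conditions `P`. -/
def IsSmallest (P : (Set Form → Set Form → Prop) → Prop)
    (C : Set Form → Set Form → Prop) : Prop :=
  (IsConsRel C ∧ Structural C ∧ NonTrivial C ∧ P C) ∧
  ∀ C' : Set Form → Set Form → Prop,
    IsConsRel C' ∧ Structural C' ∧ NonTrivial C' ∧ P C' →
    ∀ Γ Δ : Set Form, C Γ Δ → C' Γ Δ

theorem cut_aux {C : Set Form → Set Form → Prop} (hC : IsConsRel C) {Γ Δ : Set Form} (A : Form)
    (h1 : C Γ (insert A Δ)) (h2 : C (insert A Γ) Δ) : C Γ Δ := by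
  have := hC.2.2 Γ Δ Γ Δ A h1 h2
  simpa using this

theorem refl_aux {C : Set Form → Set Form → Prop} (hC : IsConsRel C) {Γ Δ : Set Form} (A : Form)
    (h1 : A ∈ Γ) (h2 : A ∈ Δ) : C Γ Δ := hC.1 _ _ ⟨A, h1, h2⟩

theorem alt_of_cl {C : Set Form → Set Form → Prop} (hC : IsConsRel C) (h : CLconds C) :
    AltConds C := by
  obtain ⟨hf, hn, hc, hd, hi⟩ := h
  have ln : ∀ (Γ Δ : Set Form) (A : Form), C (insert (Form.neg A) Γ) Δ ↔ C Γ (insert A Δ) := by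
    intro Γ Δ A
    constructor
    · intro h
      refine cut_aux hC (Form.neg A) ?_ (hC.2.1 _ _ _ _ h subset_rfl (Set.subset_insert _ _))
      rw [hn]
      exact refl_aux hC A (by simp) (by simp)
    · intro h
      refine cut_aux hC A (hC.2.1 _ _ _ _ h (Set.subset_insert _ _) subset_rfl) ?_
      rw [← hn]
      exact refl_aux hC (Form.neg A) (by simp) (by simp)
  refine ⟨⟨hf, hc, hd, hi, ?_, ?_, ?_, ?_, ?_⟩, ?_, ?_⟩
  · intro Γ Δ
    rw [hn]; exact hf _ _
  · intro Γ Δ A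
    rw [ln, hn]
  · intro Γ Δ A B
    rw [ln, ln, ln, hc]
  · intro Γ Δ A B
    rw [hn, hn, hn, hd]
  · intro Γ Δ A B
    rw [ln, hi, Set.insert_comm, ln]
  · intro A
    rw [ln]; exact refl_aux hC A (by simp) (by simp)
  · intro A
    rw [Set.pair_comm, hn]; exact refl_aux hC A (by simp) (by simp)

theorem cl_of_alt {C : Set Form → Set Form → Prop} (hC : IsConsRel C) (h : AltConds C) :
    CLconds C := by
  obtain ⟨⟨hf, hc, hd, hi, ht, -, -, -, -⟩, lnc, lem⟩ := h
  refine ⟨hf, ?_, hc, hd, hi⟩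
  intro Γ Δ A
  constructor
  · intro h
    refine cut_aux hC (Form.neg A) (hC.2.1 _ _ _ _ h (Set.subset_insert _ _) subset_rfl) ?_
    refine cut_aux hC Form.fls (hC.2.1 _ _ _ _ (lnc A) ?_ ?_) (hf _ _)
    · intro x; simp; tauto
    · intro x; simp; tauto
  · intro h
    refine cut_aux hC A ?_ (hC.2.1 _ _ _ _ h subset_rfl (Set.subset_insert _ _))
    refine cut_aux hC (Form.neg Form.fls) (ht _ _) (hC.2.1 _ _ _ _ (lem A) ?_ ?_)
    · intro x; simp; tauto
    · intro x; simp; tauto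

/-- ⊢_CL, the smallest structural non-trivial consequence relation
satisfying the original conditions, coincides with the smallest structural
non-trivial consequence relation satisfying the alternative conditions. -/
theorem stmt_0 (CL CL' : Set Form → Set Form → Prop)
    (h : IsSmallest CLconds CL) (h' : IsSmallest AltConds CL') :
    CL = CL' := by
  obtain ⟨⟨a1, a2, a3, a4⟩, a5⟩ := h
  obtain ⟨⟨b1, b2, b3, b4⟩, b5⟩ := h'
  funext Γ Δ
  exact propext ⟨a5 CL' ⟨b1, b2, b3, cl_of_alt b1 b4⟩ Γ Δ,
    b5 CL ⟨a1, a2, a3, alt_of_cl a1 a4⟩ Γ Δ⟩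
end

section
/- If a structural and non-trivial logical consequence relation ⊢ satisfies, for all sets of formulas Γ, Δ and formulas A₁, A₂: ⊥, Γ ⊢ Δ; Γ ⊢ Δ, A₁ ∧ A₂ iff (Γ ⊢ Δ, A₁ and Γ ⊢ Δ, A₂); A₁ ∨ A₂, Γ ⊢ Δ iff (A₁, Γ ⊢ Δ and A₂, Γ ⊢ Δ); Γ ⊢ Δ, A₁ → A₂ iff A₁, Γ ⊢ Δ, A₂; ¬A₁, A₁ ⊢ ⊥; ¬⊥ ⊢ A₁, ¬A₁; Γ ⊢ Δ, ¬⊥; ¬¬A₁, Γ ⊢ Δ iff A₁, Γ ⊢ Δ; ¬(A₁ ∧ A₂), Γ ⊢ Δ iff (¬A₁, Γ ⊢ Δ and ¬A₂, Γ ⊢ Δ); Γ ⊢ Δ, ¬(A₁ ∨ A₂) iff (Γ ⊢ Δ, ¬A₁ and Γ ⊢ Δ, ¬A₂); ¬(A₁ → A₂), Γ ⊢ Δ iff A₁, ¬A₂, Γ ⊢ Δ; then ⊢ also satisfies the general negation condition: Γ ⊢ Δ, ¬A if and only if A, Γ ⊢ Δ, for all Γ, Δ and all formulas A. -/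
/-- Any structural, non-trivial consequence relation satisfying
the alternative conditions also satisfies the general negation condition:
Γ ⊢ Δ, ¬A iff A, Γ ⊢ Δ. -/
theorem stmt_7 (C : Set Form → Set Form → Prop)
    (hcr : IsConsRel C) (hstr : Structural C) (hnt : NonTrivial C)
    (hconds : AltConds C) :
    ∀ (Γ Δ : Set Form) (A : Form),
      C Γ (insert (Form.neg A) Δ) ↔ C (insert A Γ) Δ := by
  obtain ⟨_, hmono, hcut⟩ := hcr
  obtain ⟨⟨hfls, _, _, _, htop, _⟩, hlnc, hlem⟩ := hconds
  intro Γ Δ A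
  constructor
  · intro h
    have h1 := hcut Γ Δ {A} {Form.fls} (Form.neg A) h (hlnc A)
    have h2 : C (Γ ∪ {A}) (insert Form.fls Δ) :=
      hmono _ _ _ _ h1 (fun _ hx => hx) (by intro x hx; simp at hx ⊢; tauto)
    have h3 := hcut _ _ ∅ Δ Form.fls h2 (hfls ∅ Δ)
    exact hmono _ _ _ _ h3 (by intro x hx; simp at hx ⊢; tauto)
      (by intro x hx; simp at hx ⊢; tauto)
  · intro h
    have h0 : C (insert (Form.neg Form.fls) ∅) {A, Form.neg A} :=
      hmono _ _ _ _ (hlem A) (by intro x hx; simp at hx ⊢; tauto) (fun _ hx => hx)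
    have h1 := hcut ∅ ∅ ∅ {A, Form.neg A} (Form.neg Form.fls) (htop ∅ ∅) h0
    have h2 : C ∅ (insert A {Form.neg A}) :=
      hmono _ _ _ _ h1 (by intro x hx; simp at hx) (by intro x hx; simpa using hx)
    have h3 := hcut ∅ {Form.neg A} Γ Δ A h2 h
    exact hmono _ _ _ _ h3 (by intro x hx; simpa using hx)
      (by intro x hx; simpa using hx)
end

section
/- Classical logic is obtained from BDL by adding the law of non-contradiction and the law of excluded middle: the smallest structural and non-trivial logical consequence relation that satisfies all the defining conditions of ⊢_BDL together with the conditions ¬A₁, A₁ ⊢ ⊥ and ¬⊥ ⊢ A₁, ¬A₁ (for all formulas A₁) coincides with ⊢_CL. -/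
theorem alt_to_cl {R : Set Form → Set Form → Prop} (hR : IsConsRel R)
    (h : BDLconds R ∧ LNC R ∧ LEM R) : CLconds R := by
  obtain ⟨-, mono, cut⟩ := hR
  obtain ⟨⟨b1, b2, b3, b4, b5, -⟩, lnc, lem⟩ := h
  refine ⟨b1, fun Γ Δ A => ⟨fun h => ?_, fun h => ?_⟩, b2, b3, b4⟩
  · have h1 := cut _ _ _ _ _ h (lnc A)
    have h2 : R (insert A Γ) (insert Form.fls Δ) :=
      mono _ _ _ _ h1 (by intro x; simp <;> tauto) (by intro x; simp <;> tauto)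
    have h3 := cut _ _ _ _ _ h2 (b1 ∅ ∅)
    exact mono _ _ _ _ h3 (by intro x; simp) (by intro x; simp)
  · have h1 := cut _ _ ∅ _ _ (b5 ∅ ∅) (mono _ _ _ _ (lem A) (by simp) subset_rfl)
    have h2 : R ∅ (insert A {Form.neg A}) :=
      mono _ _ _ _ h1 (by simp) (by simp)
    have h3 := cut _ _ _ _ _ h2 h
    exact mono _ _ _ _ h3 (by intro x; simp) (by intro x; simp)

theorem cl_to_alt {R : Set Form → Set Form → Prop} (hR : IsConsRel R)
    (h : CLconds R) : BDLconds R ∧ LNC R ∧ LEM R := by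
  obtain ⟨refl, mono, cut⟩ := hR
  obtain ⟨c1, c2, c3, c4, c5⟩ := h
  have lnc : ∀ A, R (insert A {Form.neg A}) ∅ := fun A =>
    (c2 _ _ A).1 (refl _ _ ⟨Form.neg A, by simp⟩)
  have lem : ∀ A, R ∅ (insert (Form.neg A) {A}) := fun A =>
    (c2 _ _ A).2 (refl _ _ ⟨A, by simp⟩)
  have negl : ∀ (Γ Δ : Set Form) (A : Form),
      R (insert (Form.neg A) Γ) Δ ↔ R Γ (insert A Δ) := by
    intro Γ Δ A
    constructor
    · intro h
      exact mono _ _ _ _ (cut _ _ _ _ _ (lem A) h) (by intro x; simp) (by intro x; simp)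
    · intro h
      exact mono _ _ _ _ (cut _ _ _ _ _ h (lnc A)) (by intro x; simp <;> tauto) (by intro x; simp)
  refine ⟨⟨c1, c3, c4, c5, ?_, ?_, ?_, ?_, ?_⟩, ?_, ?_⟩
  · intro Γ Δ; rw [c2]; exact c1 _ _
  · intro Γ Δ A; rw [negl, c2]
  · intro Γ Δ A B; rw [negl, negl, negl, c3]
  · intro Γ Δ A B; rw [c2, c2, c2, c4]
  · intro Γ Δ A B; rw [negl, c5, Set.insert_comm, negl]
  · intro A
    exact mono _ _ _ _ (lnc A) (by intro x; simp <;> tauto) (by simp)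
  · intro A
    exact mono _ _ _ _ (lem A) (by simp) (by intro x; simp <;> tauto)

/-- The smallest structural non-trivial consequence relation
satisfying the BDL conditions together with LNC and LEM coincides with ⊢_CL. -/
theorem stmt_9 (C CL : Set Form → Set Form → Prop)
    (h : IsSmallest (fun R => BDLconds R ∧ LNC R ∧ LEM R) C)
    (hCL : IsSmallest CLconds CL) :
    C = CL := by
  obtain ⟨⟨h1, h2, h3, h4⟩, hm⟩ := h
  obtain ⟨⟨k1, k2, k3, k4⟩, km⟩ := hCL
  funext Γ Δ
  exact propext ⟨hm CL ⟨k1, k2, k3, cl_to_alt k1 k4⟩ Γ Δ,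
    km C ⟨h1, h2, h3, alt_to_cl h1 h4⟩ Γ Δ⟩
end

section
/- BDL is paraconsistent: for distinct propositional variables p and q, it is not the case that {¬p, p} ⊢_BDL {q}. -/
/-- Four-valued semantics: (told true, told false). -/
def Form.ev (v : ℕ → Prop × Prop) : Form → Prop × Prop
  | .var p => v p
  | .fls => (False, True)
  | .neg A => ((A.ev v).2, (A.ev v).1)
  | .conj A B => ((A.ev v).1 ∧ (B.ev v).1, (A.ev v).2 ∨ (B.ev v).2)
  | .disj A B => ((A.ev v).1 ∨ (B.ev v).1, (A.ev v).2 ∧ (B.ev v).2)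
  | .impl A B => ((A.ev v).1 → (B.ev v).1, (A.ev v).1 ∧ (B.ev v).2)

def SemC (Γ Δ : Set Form) : Prop :=
  ∀ v, (∀ A ∈ Γ, (Form.ev v A).1) → ∃ B ∈ Δ, (Form.ev v B).1

theorem ev_subst (σ : ℕ → Form) (v : ℕ → Prop × Prop) (A : Form) :
    (A.subst σ).ev v = A.ev (fun n => (σ n).ev v) := by
  induction A <;> simp_all [Form.subst, Form.ev]

theorem semC_bdl : BDLconds SemC := by
  unfold BDLconds SemC
  simp only [Set.forall_mem_insert, Set.exists_mem_insert, Form.ev]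
  refine ⟨?_, ?_, ?_, ?_, ?_, ?_, ?_, ?_, ?_⟩
  · intro Γ Δ v h; exact h.1.elim
  · intro Γ Δ A B; rw [← forall_and]; exact forall_congr' fun v => by tauto
  · intro Γ Δ A B; rw [← forall_and]; exact forall_congr' fun v => by tauto
  · intro Γ Δ A B; exact forall_congr' fun v => by tauto
  · intro Γ Δ v h; exact Or.inl trivial
  · intro Γ Δ A; trivial
  · intro Γ Δ A B; rw [← forall_and]; exact forall_congr' fun v => by tauto
  · intro Γ Δ A B; rw [← forall_and]; exact forall_congr' fun v => by tauto
  · intro Γ Δ A B; exact forall_congr' fun v => by tauto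

theorem semC_cons : IsConsRel SemC := by
  refine ⟨?_, ?_, ?_⟩
  · rintro Γ Δ ⟨A, h1, h2⟩ v h
    exact ⟨A, h2, h A h1⟩
  · intro Γ Δ Γ' Δ' h hΓ hΔ v hv
    obtain ⟨B, hB, hb⟩ := h v fun A hA => hv A (hΓ hA)
    exact ⟨B, hΔ hB, hb⟩
  · intro Γ Δ Γ' Δ' A h1 h2 v hv
    obtain ⟨B, hB, hb⟩ := h1 v fun A hA => hv A (Or.inl hA)
    rcases hB with rfl | hB
    · obtain ⟨D, hD, hd⟩ := h2 v (by
        rintro E (rfl | hE)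
        · exact hb
        · exact hv E (Or.inr hE))
      exact ⟨D, Or.inr hD, hd⟩
    · exact ⟨B, Or.inl hB, hb⟩

theorem semC_struct : Structural SemC := by
  intro Γ Δ σ h v hv
  obtain ⟨B, hB, hb⟩ := h (fun n => (σ n).ev v) (fun A hA => by
    have := hv _ (Set.mem_image_of_mem _ hA)
    rwa [ev_subst] at this)
  exact ⟨_, Set.mem_image_of_mem _ hB, by rwa [ev_subst]⟩

theorem semC_para (p q : ℕ) (hpq : p ≠ q) :
    ¬ SemC {Form.neg (Form.var p), Form.var p} {Form.var q} := by
  intro h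
  have := h (fun n => (n = p, n = p)) (by
    rintro A (rfl | rfl) <;> simp [Form.ev])
  obtain ⟨B, rfl, hb⟩ := this
  exact hpq hb.symm

/-- BDL is paraconsistent: for distinct propositional variables
p and q, not {¬p, p} ⊢_BDL {q}. -/
theorem stmt_10 (BDL : Set Form → Set Form → Prop) (h : IsSmallest BDLconds BDL) :
    ∀ p q : ℕ, p ≠ q →
      ¬ BDL {Form.neg (Form.var p), Form.var p} {Form.var q} := by
  intro p q hpq hB
  exact semC_para p q hpq (h.2 SemC ⟨semC_cons, semC_struct,
    ⟨_, _, Set.insert_nonempty _ _, Set.singleton_nonempty _, semC_para p q hpq⟩, semC_bdl⟩ _ _ hB)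
end

section
/- BDL is paracomplete: for distinct propositional variables p and q, it is not the case that {q} ⊢_BDL {p, ¬p}. -/
/-- Four-valued semantics: (designated, negation designated). -/
def bdlEv (v : ℕ → Prop × Prop) : Form → Prop × Prop
  | .var p => v p
  | .fls => (False, True)
  | .neg A => ((bdlEv v A).2, (bdlEv v A).1)
  | .conj A B => ((bdlEv v A).1 ∧ (bdlEv v B).1, (bdlEv v A).2 ∨ (bdlEv v B).2)
  | .disj A B => ((bdlEv v A).1 ∨ (bdlEv v B).1, (bdlEv v A).2 ∧ (bdlEv v B).2)
  | .impl A B => ((bdlEv v A).1 → (bdlEv v B).1, (bdlEv v A).1 ∧ (bdlEv v B).2)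

def bdlC (Γ Δ : Set Form) : Prop :=
  ∀ v, (∀ A ∈ Γ, (bdlEv v A).1) → ∃ B ∈ Δ, (bdlEv v B).1

theorem bdlEv_subst (v : ℕ → Prop × Prop) (σ : ℕ → Form) (A : Form) :
    bdlEv v (A.subst σ) = bdlEv (fun p => bdlEv v (σ p)) A := by
  induction A <;> simp_all [Form.subst, bdlEv]

theorem bdlC_notLEM (p q : ℕ) (hpq : p ≠ q) :
    ¬ bdlC {Form.var q} {Form.var p, Form.neg (Form.var p)} := by
  intro h
  have := h (fun n => (n = q, False)) (by simp [bdlEv])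
  simp [bdlEv, hpq] at this

theorem bdlC_cons : IsConsRel bdlC := by
  refine ⟨?_, ?_, ?_⟩
  · rintro Γ Δ ⟨A, h1, h2⟩ v hv
    exact ⟨A, h2, hv A h1⟩
  · intro Γ Δ Γ' Δ' h h1 h2 v hv
    obtain ⟨B, hB, hB'⟩ := h v (fun A hA => hv A (h1 hA))
    exact ⟨B, h2 hB, hB'⟩
  · intro Γ Δ Γ' Δ' A h1 h2 v hv
    obtain ⟨B, hB, hB'⟩ := h1 v (fun A hA => hv A (Or.inl hA))
    rcases hB with rfl | hB
    · obtain ⟨D, hD, hD'⟩ := h2 v (by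
        rintro E (rfl | hE)
        · exact hB'
        · exact hv E (Or.inr hE))
      exact ⟨D, Or.inr hD, hD'⟩
    · exact ⟨B, Or.inl hB, hB'⟩

theorem bdlC_struct : Structural bdlC := by
  intro Γ Δ σ h v hv
  obtain ⟨B, hB, hB'⟩ := h (fun p => bdlEv v (σ p)) (fun A hA => by
    rw [← bdlEv_subst]; exact hv _ ⟨A, hA, rfl⟩)
  exact ⟨_, ⟨B, hB, rfl⟩, by rw [bdlEv_subst]; exact hB'⟩

theorem bdlC_conds : BDLconds bdlC := by
  refine ⟨?_, ?_, ?_, ?_, ?_, ?_, ?_, ?_, ?_⟩ <;> intros <;>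
    simp only [bdlC, Set.mem_insert_iff, forall_eq_or_imp, exists_eq_or_imp, bdlEv,
      ← forall_and] <;>
    first
    | (refine forall_congr' fun v => ?_; tauto)
    | (intro v; tauto)

/-- BDL is paracomplete: for distinct propositional variables
p and q, not {q} ⊢_BDL {p, ¬p}. -/
theorem stmt_11 (BDL : Set Form → Set Form → Prop) (h : IsSmallest BDLconds BDL) :
    ∀ p q : ℕ, p ≠ q →
      ¬ BDL {Form.var q} {Form.var p, Form.neg (Form.var p)} := by
  intro p q hpq hB
  refine bdlC_notLEM p q hpq (h.2 bdlC ⟨bdlC_cons, bdlC_struct, ?_, bdlC_conds⟩ _ _ hB)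
  exact ⟨_, _, by simp, by simp, bdlC_notLEM p q hpq⟩
end

section
/- The logic obtained from classical logic by dropping only the law of excluded middle is paracomplete: letting ⊢_K3L be the smallest structural and non-trivial logical consequence relation satisfying all the defining conditions of ⊢_BDL together with ¬A₁, A₁ ⊢ ⊥ for all formulas A₁, for distinct propositional variables p and q it is not the case that {q} ⊢_K3L {p, ¬p}. -/
/-- Three-valued evaluation: (is true, is false). -/
def ev3 (v : ℕ → Prop × Prop) : Form → Prop × Prop
  | .var p => v p
  | .fls => (False, True)
  | .neg A => ((ev3 v A).2, (ev3 v A).1)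
  | .conj A B => ((ev3 v A).1 ∧ (ev3 v B).1, (ev3 v A).2 ∨ (ev3 v B).2)
  | .disj A B => ((ev3 v A).1 ∨ (ev3 v B).1, (ev3 v A).2 ∧ (ev3 v B).2)
  | .impl A B => ((ev3 v A).1 → (ev3 v B).1, (ev3 v A).1 ∧ (ev3 v B).2)

def Cons3 (v : ℕ → Prop × Prop) : Prop := ∀ n, ¬ ((v n).1 ∧ (v n).2)

theorem ev3_cons (v : ℕ → Prop × Prop) (hv : Cons3 v) (A : Form) :
    ¬ ((ev3 v A).1 ∧ (ev3 v A).2) := by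
  induction A with
  | var n => exact hv n
  | fls => simp [ev3]
  | neg A ih => simp only [ev3]; tauto
  | conj A B ihA ihB => simp only [ev3]; tauto
  | disj A B ihA ihB => simp only [ev3]; tauto
  | impl A B ihA ihB => simp only [ev3]; tauto

theorem ev3_subst (v : ℕ → Prop × Prop) (σ : ℕ → Form) (A : Form) :
    ev3 v (A.subst σ) = ev3 (fun n => ev3 v (σ n)) A := by
  induction A <;> simp_all [ev3, Form.subst]

def C3 (Γ Δ : Set Form) : Prop :=
  ∀ v, Cons3 v → (∀ A ∈ Γ, (ev3 v A).1) → ∃ A ∈ Δ, (ev3 v A).1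

theorem C3_cons : IsConsRel C3 := by
  refine ⟨?_, ?_, ?_⟩
  · rintro Γ Δ ⟨A, h1, h2⟩ v hv h
    exact ⟨A, h2, h A h1⟩
  · intro Γ Δ Γ' Δ' h h1 h2 v hv hΓ
    obtain ⟨A, hA, hh⟩ := h v hv (fun A hA => hΓ A (h1 hA))
    exact ⟨A, h2 hA, hh⟩
  · intro Γ Δ Γ' Δ' A h1 h2 v hv hΓ
    obtain ⟨B, hB, hh⟩ := h1 v hv (fun A hA => hΓ A (Or.inl hA))
    rcases hB with rfl | hB
    · obtain ⟨D, hD, hh'⟩ := h2 v hv (by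
        rintro D (rfl | hD)
        · exact hh
        · exact hΓ D (Or.inr hD))
      exact ⟨D, Or.inr hD, hh'⟩
    · exact ⟨B, Or.inl hB, hh⟩

theorem C3_struct : Structural C3 := by
  intro Γ Δ σ h v hv hΓ
  obtain ⟨A, hA, hh⟩ := h (fun n => ev3 v (σ n)) (fun n => ev3_cons v hv (σ n))
    (fun A hA => by rw [← ev3_subst]; exact hΓ _ ⟨A, hA, rfl⟩)
  exact ⟨_, ⟨A, hA, rfl⟩, by rw [ev3_subst]; exact hh⟩

theorem C3_not (p q : ℕ) (hpq : p ≠ q) :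
    ¬ C3 {Form.var q} {Form.var p, Form.neg (Form.var p)} := by
  intro h
  have := h (fun n => (n = q, False)) (by simp [Cons3]) (by simp [ev3])
  simp [ev3, hpq] at this

theorem C3_bdl : BDLconds C3 := by
  refine ⟨?_, ?_, ?_, ?_, ?_, ?_, ?_, ?_, ?_⟩
  · intro Γ Δ
    simp [C3, ev3]
  · intro Γ Δ A B
    simp only [C3, ev3, Set.mem_insert_iff, exists_eq_or_imp, ← forall_and]
    refine forall_congr' fun v => ?_
    tauto
  · intro Γ Δ A B
    simp only [C3, ev3, Set.mem_insert_iff, forall_eq_or_imp, ← forall_and]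
    refine forall_congr' fun v => ?_
    tauto
  · intro Γ Δ A B
    simp only [C3, ev3, Set.mem_insert_iff, forall_eq_or_imp, exists_eq_or_imp]
    refine forall_congr' fun v => ?_
    tauto
  · intro Γ Δ
    simp [C3, ev3]
  · intro Γ Δ A
    simp only [C3, ev3, Set.mem_insert_iff, forall_eq_or_imp]
  · intro Γ Δ A B
    simp only [C3, ev3, Set.mem_insert_iff, forall_eq_or_imp, ← forall_and]
    refine forall_congr' fun v => ?_
    tauto
  · intro Γ Δ A B
    simp only [C3, ev3, Set.mem_insert_iff, exists_eq_or_imp, ← forall_and]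
    refine forall_congr' fun v => ?_
    tauto
  · intro Γ Δ A B
    simp only [C3, ev3, Set.mem_insert_iff, forall_eq_or_imp]
    refine forall_congr' fun v => ?_
    tauto

theorem C3_lnc : LNC C3 := by
  intro A v hv h
  exact absurd ⟨h A (by simp), h (Form.neg A) (by simp)⟩ (ev3_cons v hv A)

/-- The logic obtained by dropping only LEM is paracomplete:
where ⊢_K3L is the smallest structural non-trivial consequence relation
satisfying the BDL conditions together with LNC, for distinct propositional
variables p and q, not {q} ⊢_K3L {p, ¬p}. -/
theorem stmt_15 (K3L : Set Form → Set Form → Prop)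
    (h : IsSmallest (fun R => BDLconds R ∧ LNC R) K3L) :
    ∀ p q : ℕ, p ≠ q →
      ¬ K3L {Form.var q} {Form.var p, Form.neg (Form.var p)} := by 
  intro p q hpq hK
  exact C3_not p q hpq (h.2 C3 ⟨C3_cons, C3_struct,
    ⟨_, _, Set.singleton_nonempty _, Set.insert_nonempty _ _, C3_not p q hpq⟩,
    C3_bdl, C3_lnc⟩ _ _ hK)
end
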